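/- arXiv:2406.15141 — 2 statements merged into one kernel-verified Lean document; each statement's English description precedes it below -/
import Mathlib

section
/- Let d ≥ 1, let μ be the Haar probability measure on the unitary group U(d) of d×d complex matrices, let ρ be a d×d complex matrix with ρᴴ = ρ, ρ·ρ = ρ and Tr(ρ) = 1 (a pure state), and let M be a ℂ-linear endomorphism of the space of d×d complex matrices. Then ∫_{U(d)} Tr( M(U·ρ·Uᴴ) · (U·ρ·Uᴴ) ) dμ(U) = ( tr(M) + Tr(M(1)) ) / ( d(d+1) ), where tr(M) is the trace of M as a linear operator on the d²-dimensional space of matrices and M(1) is the image of the identity matrix under M. -/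
open scoped Matrix
open MeasureTheory

/-- The Borel σ-algebra on matrices (with the usual product topology). -/
noncomputable instance matrixMeasurableSpace {d : ℕ} :
    MeasurableSpace (Matrix (Fin d) (Fin d) ℂ) := borel _

instance matrixBorelSpace {d : ℕ} : BorelSpace (Matrix (Fin d) (Fin d) ℂ) := ⟨rfl⟩

open Matrix

/-- An idempotent matrix of trace one is an outer product. -/
theorem exists_eq_vecMulVec_of_isIdempotentElem {n K : Type*} [Fintype n] [DecidableEq n] [Field K]
    [CharZero K] {A : Matrix n n K} (hA : IsIdempotentElem A) (htr : A.trace = 1) :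
    ∃ u w : n → K, A = vecMulVec u w ∧ w ⬝ᵥ u = 1 := by
  have hid : IsIdempotentElem (toLin' A) := by
    rw [IsIdempotentElem, Module.End.mul_eq_comp, ← toLin'_mul, hA.eq]
  have hrank : Module.finrank K (LinearMap.range (toLin' A)) = 1 := by
    have := (LinearMap.IsIdempotentElem.isProj_range _ hid).trace
    rw [trace_toLin'_eq, htr] at this
    exact_mod_cast this.symm
  obtain ⟨v, -, hv⟩ := finrank_eq_one_iff'.mp hrank
  choose c hc using fun j => hv ⟨toLin' A (Pi.single j 1), LinearMap.mem_range_self _ _⟩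
  have key : A = vecMulVec (v : n → K) c := by
    ext i j
    have := congrFun (congrArg Subtype.val (hc j)) i
    simp at this
    simp [vecMulVec_apply, ← this, mul_comm]
  refine ⟨v, c, key, ?_⟩
  rw [← htr, congrArg trace key, trace_vecMulVec, dotProduct_comm]

instance unitaryGroup_compactSpace {d : ℕ} : CompactSpace (unitaryGroup (Fin d) ℂ) := by
  refine isCompact_iff_compactSpace.mp <| (isCompact_univ_pi fun _ => isCompact_univ_pi fun _ =>
    isCompact_closedBall (0 : ℂ) 1).of_isClosed_subset
    (isClosed_unitary (R := Matrix (Fin d) (Fin d) ℂ)) fun U hU i _ j _ => ?_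
  simpa using entry_norm_bound_of_unitary hU i j

section UnitaryMoment

variable {d : ℕ} (μ : Measure (unitaryGroup (Fin d) ℂ)) (u w : Fin d → ℂ)

/-- The moment `∫ (U u)ᵢ (w Uᴴ)ⱼ (U u)ₖ (w Uᴴ)ₗ dμ(U)`. -/
noncomputable def unitaryMoment (i j k l : Fin d) : ℂ :=
  ∫ U : unitaryGroup (Fin d) ℂ,
    (U.1 *ᵥ u) i * (w ᵥ* U.1ᴴ) j * (U.1 *ᵥ u) k * (w ᵥ* U.1ᴴ) l ∂μ

theorem unitaryMoment_comm_left (i j k l : Fin d) :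
    unitaryMoment μ u w i j k l = unitaryMoment μ u w k j i l := by
  simp only [unitaryMoment]
  congr 1 with U
  ring

theorem unitaryMoment_comm_right (i j k l : Fin d) :
    unitaryMoment μ u w i j k l = unitaryMoment μ u w i l k j := by
  simp only [unitaryMoment]
  congr 1 with U
  ring

theorem integrable_unitaryMoment [IsFiniteMeasure μ] (i j k l : Fin d) :
    Integrable (fun U : unitaryGroup (Fin d) ℂ =>
      (U.1 *ᵥ u) i * (w ᵥ* U.1ᴴ) j * (U.1 *ᵥ u) k * (w ᵥ* U.1ᴴ) l) μ := by
  refine Continuous.integrable_of_hasCompactSupport ?_ (HasCompactSupport.of_compactSpace _)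
  have hl : Continuous fun U : unitaryGroup (Fin d) ℂ => U.1 *ᵥ u :=
    continuous_subtype_val.matrix_mulVec continuous_const
  have hr : Continuous fun U : unitaryGroup (Fin d) ℂ => w ᵥ* U.1ᴴ :=
    continuous_const.matrix_vecMul continuous_subtype_val.matrix_conjTranspose
  fun_prop

/-- Left invariance of the Haar measure, for integrands depending on `U u` and `w Uᴴ`. -/
theorem integral_unitaryGroup_conj [μ.IsMulLeftInvariant] (V : unitaryGroup (Fin d) ℂ)
    (g : (Fin d → ℂ) → (Fin d → ℂ) → ℂ) :
    ∫ U : unitaryGroup (Fin d) ℂ, g (V.1 *ᵥ (U.1 *ᵥ u)) ((w ᵥ* U.1ᴴ) ᵥ* V.1ᴴ) ∂μ =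
      ∫ U : unitaryGroup (Fin d) ℂ, g (U.1 *ᵥ u) (w ᵥ* U.1ᴴ) ∂μ := by
  rw [← integral_mul_left_eq_self
    (fun U : unitaryGroup (Fin d) ℂ => g (U.1 *ᵥ u) (w ᵥ* U.1ᴴ)) V]
  simp [mulVec_mulVec, vecMul_vecMul]

/-- The diagonal unitary matrix with entry `I` at `p` and `1` elsewhere. -/
noncomputable def diagonalPhase (p : Fin d) : unitaryGroup (Fin d) ℂ :=
  ⟨diagonal (Function.update 1 p Complex.I), by
    rw [mem_unitaryGroup_iff, star_eq_conjTranspose, diagonal_conjTranspose, diagonal_mul_diagonal,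
      ← diagonal_one]
    congr 1 with i
    by_cases h : i = p <;> simp [h]⟩

theorem unitaryMoment_eq_phase_mul [μ.IsMulLeftInvariant] (p i j k l : Fin d) :
    unitaryMoment μ u w i j k l =
      (if i = p then Complex.I else 1) * (if j = p then -Complex.I else 1) *
        (if k = p then Complex.I else 1) * (if l = p then -Complex.I else 1) *
        unitaryMoment μ u w i j k l := by
  conv_lhs =>
    rw [unitaryMoment, ← integral_unitaryGroup_conj μ u w (diagonalPhase p)
      fun x y => x i * y j * x k * y l]
  rw [unitaryMoment, ← integral_const_mul]
  congr 1 with U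
  simp only [diagonalPhase, diagonal_conjTranspose, mulVec_diagonal, vecMul_diagonal,
    Function.update_apply, Pi.star_apply, Pi.one_apply]
  have hstar (a : Fin d) : star (if a = p then Complex.I else 1) =
      if a = p then -Complex.I else 1 := by
    split_ifs <;> simp
  rw [hstar, hstar]
  ring

theorem unitaryMoment_eq_zero [μ.IsMulLeftInvariant] {i j k l : Fin d}
    (h₁ : ¬(i = j ∧ k = l)) (h₂ : ¬(i = l ∧ k = j)) : unitaryMoment μ u w i j k l = 0 := by
  have hI : Complex.I ≠ 1 := by simp [Complex.ext_iff]
  have hI' : -Complex.I ≠ 1 := by simp [Complex.ext_iff]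
  have hi := unitaryMoment_eq_phase_mul μ u w i i j k l
  have hk := unitaryMoment_eq_phase_mul μ u w k i j k l
  have aux {c z : ℂ} (hc : c ≠ 1) (hz : z = c * z) : z = 0 := by
    by_contra h0
    exact hc (mul_right_cancel₀ h0 (by rw [one_mul, ← hz]))
  by_cases hij : i = j
  · subst hij
    have hkl : l ≠ k := fun h => h₁ ⟨rfl, h.symm⟩
    refine aux hI (hk.trans ?_)
    by_cases h : i = k <;> simp [h, hkl]
  · by_cases hil : i = l
    · subst hil
      have hkj : j ≠ k := fun h => h₂ ⟨rfl, h.symm⟩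
      refine aux hI (hk.trans ?_)
      by_cases h : i = k <;> simp [h, hkj]
    · rw [if_pos rfl, if_neg (Ne.symm hij), if_neg (Ne.symm hil)] at hi
      by_cases h : k = i
      · exact aux (c := -1) (by norm_num) (by simpa [h] using hi)
      · exact aux hI (by simpa [h] using hi)

/-- The reflection `1 - (2/5) n nᵀ` with `n = eᵢ + 2 eⱼ`. -/
noncomputable def pythagoreanReflection {i j : Fin d} (hij : i ≠ j) : unitaryGroup (Fin d) ℂ :=
  ⟨1 - (2 / 5 : ℂ) • vecMulVec (Pi.single i 1 + Pi.single j 2) (Pi.single i 1 + Pi.single j 2), by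
    have hself : star (1 - (2 / 5 : ℂ) • vecMulVec (Pi.single i 1 + Pi.single j 2 : Fin d → ℂ)
        (Pi.single i 1 + Pi.single j 2)) = 1 - (2 / 5 : ℂ) •
          vecMulVec (Pi.single i 1 + Pi.single j 2) (Pi.single i 1 + Pi.single j 2) := by
      rw [star_eq_conjTranspose, conjTranspose_sub, conjTranspose_one, conjTranspose_smul,
        conjTranspose_vecMulVec]
      simp
    rw [mem_unitaryGroup_iff, hself]
    have hn : (Pi.single i 1 + Pi.single j 2 : Fin d → ℂ) ⬝ᵥ
        (Pi.single i 1 + Pi.single j 2) = 5 := by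
      simp [hij, hij.symm]
      norm_num
    rw [sub_mul, mul_sub, one_mul, one_mul, mul_sub, mul_one, smul_mul_smul_comm, vecMulVec_mul_vecMulVec, hn]
    ext a b
    simp [vecMulVec_apply]
    ring⟩

theorem pythagoreanReflection_mulVec {i j : Fin d} (hij : i ≠ j) (x : Fin d → ℂ) :
    ((pythagoreanReflection hij).1 *ᵥ x) i = 3 / 5 * x i - 4 / 5 * x j := by
  simp [pythagoreanReflection, sub_mulVec, smul_mulVec, vecMulVec_mulVec, hij]
  ring

theorem vecMul_conjTranspose_pythagoreanReflection {i j : Fin d} (hij : i ≠ j) (x : Fin d → ℂ) :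
    (x ᵥ* (pythagoreanReflection hij).1ᴴ) i = 3 / 5 * x i - 4 / 5 * x j := by
  simp [pythagoreanReflection, conjTranspose_vecMulVec, vecMul_sub, vecMul_smul, vecMul_vecMulVec,
    hij]
  ring

theorem sum_mul_sum_mul_sum_mul_sum {ι R : Type*} [Fintype ι] [CommSemiring R]
    (f g h k : ι → R) :
    (∑ a, f a) * (∑ a, g a) * (∑ a, h a) * (∑ a, k a) =
      ∑ p : ι × ι × ι × ι, f p.1 * g p.2.1 * h p.2.2.1 * k p.2.2.2 := by
  simp only [Fintype.sum_prod_type, mul_assoc, ← Finset.mul_sum, ← Finset.sum_mul]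

theorem integral_sum_mul_sum [IsFiniteMeasure μ] {ι : Type*} [Fintype ι] (r : ι → ℂ)
    (s : ι → Fin d) :
    ∫ U : unitaryGroup (Fin d) ℂ,
      (∑ a, r a * (U.1 *ᵥ u) (s a)) * (∑ a, r a * (w ᵥ* U.1ᴴ) (s a)) *
        (∑ a, r a * (U.1 *ᵥ u) (s a)) * (∑ a, r a * (w ᵥ* U.1ᴴ) (s a)) ∂μ =
      ∑ p : ι × ι × ι × ι, r p.1 * r p.2.1 * r p.2.2.1 * r p.2.2.2 *
        unitaryMoment μ u w (s p.1) (s p.2.1) (s p.2.2.1) (s p.2.2.2) := by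
  simp only [unitaryMoment, ← integral_const_mul]
  rw [← integral_finsetSum _ fun p _ => (integrable_unitaryMoment μ u w _ _ _ _).const_mul _]
  congr 1 with U
  rw [sum_mul_sum_mul_sum_mul_sum]
  refine Finset.sum_congr rfl fun p _ => ?_
  ring

theorem unitaryMoment_self_eq [IsFiniteMeasure μ] [μ.IsMulLeftInvariant] {i j : Fin d}
    (hij : i ≠ j) :
    625 * unitaryMoment μ u w i i i i = 81 * unitaryMoment μ u w i i i i +
      256 * unitaryMoment μ u w j j j j + 576 * unitaryMoment μ u w i i j j := by
  have h := integral_unitaryGroup_conj μ u w (pythagoreanReflection hij)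
    fun x y => x i * y i * x i * y i
  have h' := integral_sum_mul_sum μ u w ![3 / 5, -4 / 5] ![i, j]
  simp only [pythagoreanReflection_mulVec, vecMul_conjTranspose_pythagoreanReflection] at h
  simp only [Fin.sum_univ_two, Fintype.sum_prod_type, cons_val_zero, cons_val_one, neg_div,
    neg_mul, ← sub_eq_add_neg] at h'
  rw [h', ← unitaryMoment] at h
  have h₁ := unitaryMoment_comm_left μ u w i i j j
  have h₂ := unitaryMoment_comm_right μ u w i i j j
  have h₃ := unitaryMoment_comm_right μ u w j i i j
  have z {a b c e : Fin d} := @unitaryMoment_eq_zero d μ u w _ a b c e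
  simp [z, hij, hij.symm] at h
  linear_combination -625 * h - 288 * h₁ - 144 * h₂ - 144 * h₃

theorem unitaryMoment_self_eq_two_mul [IsFiniteMeasure μ] [μ.IsMulLeftInvariant] {i j : Fin d}
    (hij : i ≠ j) : unitaryMoment μ u w i i i i = 2 * unitaryMoment μ u w i i j j := by
  have h₁ := unitaryMoment_self_eq μ u w hij
  have h₂ := unitaryMoment_self_eq μ u w hij.symm
  rw [unitaryMoment_comm_left μ u w j j i i, unitaryMoment_comm_right μ u w i j j i] at h₂
  linear_combination (17 / 7200) * h₁ + (8 / 7200) * h₂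

theorem unitaryMoment_self_eq_self [IsFiniteMeasure μ] [μ.IsMulLeftInvariant] (i j : Fin d) :
    unitaryMoment μ u w i i i i = unitaryMoment μ u w j j j j := by
  by_cases hij : i = j
  · rw [hij]
  rw [unitaryMoment_self_eq_two_mul μ u w hij, unitaryMoment_self_eq_two_mul μ u w (Ne.symm hij),
    unitaryMoment_comm_left, unitaryMoment_comm_right]

theorem sum_unitaryMoment [IsProbabilityMeasure μ] (huw : w ⬝ᵥ u = 1) :
    ∑ i, ∑ k, unitaryMoment μ u w i i k k = 1 := by
  have hone (U : unitaryGroup (Fin d) ℂ) : (U.1 *ᵥ u) ⬝ᵥ (w ᵥ* U.1ᴴ) = 1 := by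
    rw [dotProduct_comm, ← dotProduct_mulVec, mulVec_mulVec, ← star_eq_conjTranspose,
      mem_unitaryGroup_iff'.mp U.2, one_mulVec, huw]
  simp only [unitaryMoment]
  simp_rw [← integral_finsetSum _ fun k _ => integrable_unitaryMoment μ u w _ _ k _]
  rw [← integral_finsetSum _ fun i _ => integrable_finsetSum _
    fun k _ => integrable_unitaryMoment μ u w _ _ _ _]
  have : ∀ U : unitaryGroup (Fin d) ℂ, ∑ i, ∑ k,
      (U.1 *ᵥ u) i * (w ᵥ* U.1ᴴ) i * (U.1 *ᵥ u) k * (w ᵥ* U.1ᴴ) k = 1 := fun U => by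
    simp only [mul_assoc _ ((U.1 *ᵥ u) _), ← Finset.mul_sum]
    simpa [← Finset.sum_mul, dotProduct] using congrArg₂ (· * ·) (hone U) (hone U)
  simp [this]

theorem unitaryMoment_eq [IsProbabilityMeasure μ] [μ.IsMulLeftInvariant] (huw : w ⬝ᵥ u = 1)
    (i j k l : Fin d) :
    unitaryMoment μ u w i j k l =
      ((if i = j ∧ k = l then 1 else 0) + if i = l ∧ k = j then 1 else 0) /
        ((d : ℂ) * ((d : ℂ) + 1)) := by
  have hd : (d : ℂ) ≠ 0 := by
    have := i.pos
    exact_mod_cast this.ne'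
  have hd' : (d : ℂ) + 1 ≠ 0 := by exact_mod_cast d.succ_ne_zero
  obtain ⟨c, hpair⟩ : ∃ c : ℂ, ∀ a b : Fin d, unitaryMoment μ u w a a b b =
      c * (1 + if a = b then 1 else 0) := by
    refine ⟨unitaryMoment μ u w i i i i / 2, fun a b => ?_⟩
    rw [unitaryMoment_self_eq_self μ u w i a]
    by_cases hab : a = b
    · rw [hab, if_pos rfl]
      ring
    · simp [hab, unitaryMoment_self_eq_two_mul μ u w hab]
  have hval : c = 1 / ((d : ℂ) * ((d : ℂ) + 1)) := by
    have h := sum_unitaryMoment μ u w huw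
    simp only [hpair, ← Finset.mul_sum, Finset.sum_add_distrib] at h
    simp at h
    rw [eq_div_iff (mul_ne_zero hd hd')]
    linear_combination h
  rw [hval] at hpair
  by_cases h₁ : i = j ∧ k = l
  · obtain ⟨rfl, rfl⟩ := h₁
    rw [hpair]
    by_cases h : i = k
    · simp only [h, and_self, if_true]
      ring
    · simp [h]
  · by_cases h₂ : i = l ∧ k = j
    · obtain ⟨rfl, rfl⟩ := h₂
      rw [unitaryMoment_comm_right, hpair]
      have h : i ≠ k := fun h => h₁ ⟨h, h.symm⟩
      simp [h]
    · rw [unitaryMoment_eq_zero μ u w h₁ h₂]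
      simp [h₁, h₂]

end UnitaryMoment

theorem trace_matrixEnd_eq_sum {n R : Type*} [Fintype n] [DecidableEq n] [CommRing R]
    (M : Matrix n n R →ₗ[R] Matrix n n R) :
    LinearMap.trace R (Matrix n n R) M = ∑ i, ∑ j, M (Matrix.single i j 1) i j := by
  rw [LinearMap.trace_eq_matrix_trace R (stdBasis R n n), Matrix.trace, Fintype.sum_prod_type]
  have hrepr (A : Matrix n n R) (i j : n) : (stdBasis R n n).repr A (i, j) = A i j := by
    simp [stdBasis]
  simp [LinearMap.toMatrix_apply, stdBasis_eq_single, hrepr]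

theorem trace_apply_vecMulVec_mul {n R : Type*} [Fintype n] [DecidableEq n] [CommRing R]
    (M : Matrix n n R →ₗ[R] Matrix n n R) (x y : n → R) :
    (M (vecMulVec x y) * vecMulVec x y).trace =
      ∑ p : n × n × n × n, M (single p.1 p.2.1 1) p.2.2.2 p.2.2.1 *
        (x p.1 * y p.2.1 * x p.2.2.1 * y p.2.2.2) := by
  have h : M (vecMulVec x y) = ∑ i, ∑ j, (x i * y j) • M (single i j 1) := by
    conv_lhs => rw [matrix_eq_sum_single (vecMulVec x y)]
    simp only [map_sum, ← map_smul, smul_single, vecMulVec_apply, smul_eq_mul, mul_one]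
  rw [h]
  simp only [mul_vecMulVec, trace_vecMulVec, Fintype.sum_prod_type, sum_mulVec, smul_mulVec,
    sum_dotProduct, smul_dotProduct]
  refine Finset.sum_congr rfl fun i _ => Finset.sum_congr rfl fun j _ => ?_
  rw [dotProduct_comm, dotProduct_mulVec, dotProduct_comm]
  simp only [dotProduct, vecMul, smul_eq_mul, Finset.mul_sum]
  refine Finset.sum_congr rfl fun a _ => Finset.sum_congr rfl fun b _ => ?_
  ring

/-- Integral over the Haar probability measure on the unitary group:
for a pure state `ρ` and a linear superoperator `M`,
`∫ Tr(M(UρUᴴ) UρUᴴ) dμ(U) = (tr M + Tr(M 1)) / (d(d+1))`. -/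
theorem haar_integral_trace_superoperator {d : ℕ} (hd : 1 ≤ d)
    (μ : Measure (Matrix.unitaryGroup (Fin d) ℂ))
    [μ.IsHaarMeasure] [IsProbabilityMeasure μ]
    (ρ : Matrix (Fin d) (Fin d) ℂ) (hρ_herm : ρᴴ = ρ) (hρ_proj : ρ * ρ = ρ)
    (hρ_tr : ρ.trace = 1)
    (M : Matrix (Fin d) (Fin d) ℂ →ₗ[ℂ] Matrix (Fin d) (Fin d) ℂ) :
    (∫ U : Matrix.unitaryGroup (Fin d) ℂ,
        (M ((U : Matrix (Fin d) (Fin d) ℂ) * ρ * (U : Matrix (Fin d) (Fin d) ℂ)ᴴ) *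
          ((U : Matrix (Fin d) (Fin d) ℂ) * ρ * (U : Matrix (Fin d) (Fin d) ℂ)ᴴ)).trace ∂μ) =
      (LinearMap.trace ℂ (Matrix (Fin d) (Fin d) ℂ) M + (M 1).trace) /
        ((d : ℂ) * ((d : ℂ) + 1)) := by
  obtain ⟨u, w, rfl, huw⟩ := exists_eq_vecMulVec_of_isIdempotentElem hρ_proj hρ_tr
  have hconj (U : unitaryGroup (Fin d) ℂ) :
      U.1 * vecMulVec u w * U.1ᴴ = vecMulVec (U.1 *ᵥ u) (w ᵥ* U.1ᴴ) := by
    rw [mul_vecMulVec, vecMulVec_mul]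
  simp only [hconj, trace_apply_vecMulVec_mul]
  rw [integral_finsetSum _ fun p _ => (integrable_unitaryMoment μ u w _ _ _ _).const_mul _]
  have hm (i j k l : Fin d) := unitaryMoment_eq μ u w huw i j k l
  simp only [unitaryMoment] at hm
  simp only [integral_const_mul, hm, mul_div_assoc', ← Finset.sum_div]
  congr 1
  have hone : (1 : Matrix (Fin d) (Fin d) ℂ) = ∑ i, single i i 1 := by
    rw [← diagonal_one, ← sum_single_eq_diagonal]
  rw [trace_matrixEnd_eq_sum, hone, map_sum, trace_sum, add_comm]
  simp only [mul_add, Finset.sum_add_distrib, Fintype.sum_prod_type]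
  simp [ite_and, Finset.sum_ite_irrel, trace]
end

section
/- Let d ≥ 1 and let L be a d×d complex matrix with Tr(L) = 0. Let L* denote the entrywise complex conjugate of L, set C = Lᴴ·L, and define the Lindblad superoperator matrix 𝓛 = L* ⊗ L − (1/2)·( C ⊗ 1 + (1 ⊗ C)ᵀ ), where ⊗ is the Kronecker product. Then Tr(𝓛·𝓛) = |Tr(L·L)|² + (1/2)·(Tr C)² + (d/2)·Tr(C·C). -/
open scoped Matrix Kronecker

/-- For traceless `L`, the trace of the square of the Lindblad superoperator
`𝓛 = L* ⊗ L - ½(LᴴL ⊗ 1 + (1 ⊗ LᴴL)ᵀ)` equals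
`|Tr(L²)|² + ½(Tr LᴴL)² + (d/2) Tr((LᴴL)²)`. -/
theorem trace_lindblad_superoperator_sq {d : ℕ} (hd : 1 ≤ d)
    (L : Matrix (Fin d) (Fin d) ℂ) (hL : L.trace = 0) :
    ((L.map (starRingEnd ℂ) ⊗ₖ L -
          (1 / 2 : ℂ) • ((Lᴴ * L) ⊗ₖ (1 : Matrix (Fin d) (Fin d) ℂ) +
            ((1 : Matrix (Fin d) (Fin d) ℂ) ⊗ₖ (Lᴴ * L))ᵀ)) *
        (L.map (starRingEnd ℂ) ⊗ₖ L -
          (1 / 2 : ℂ) • ((Lᴴ * L) ⊗ₖ (1 : Matrix (Fin d) (Fin d) ℂ) +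
            ((1 : Matrix (Fin d) (Fin d) ℂ) ⊗ₖ (Lᴴ * L))ᵀ))).trace =
      (starRingEnd ℂ) (L * L).trace * (L * L).trace +
        (1 / 2 : ℂ) * (Lᴴ * L).trace ^ 2 +
        ((d : ℂ) / 2) * ((Lᴴ * L) * (Lᴴ * L)).trace := by
  have hLc : (L.map (starRingEnd ℂ)).trace = 0 := by
    rw [← AddMonoidHom.map_trace, hL, map_zero]
  have hLL : (L.map (starRingEnd ℂ) * L.map (starRingEnd ℂ)).trace =
      (starRingEnd ℂ) (L * L).trace := by
    rw [← Matrix.map_mul, ← AddMonoidHom.map_trace]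
  generalize Lᴴ * L = C
  have hC : (Cᵀ * Cᵀ).trace = (C * C).trace := by
    rw [← Matrix.transpose_mul, Matrix.trace_transpose]
  rw [← Matrix.kroneckerMap_transpose, Matrix.transpose_one]
  simp only [sub_mul, mul_sub, add_mul, mul_add, smul_add, Matrix.smul_mul, Matrix.mul_smul,
    ← Matrix.mul_kronecker_mul, Matrix.trace_sub, Matrix.trace_add, Matrix.trace_smul,
    Matrix.trace_kronecker, Matrix.one_mul, Matrix.mul_one, Matrix.trace_one, Fintype.card_fin,
    Matrix.trace_transpose, smul_eq_mul, hL, hLc, hLL, hC]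
  ring
end
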